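/- Every finite set-homogeneous tournament is homogeneous; consequently, a finite set-homogeneous tournament either has exactly one vertex or is isomorphic to the directed triangle D_3. -/

import Mathlib

/-- An a-digraph structure: a binary arc relation on the vertex type. -/
structure ADigraph (V : Type*) where
  arc : V → V → Prop

namespace ADigraph

variable {V W : Type*}

/-- The a-digraph axioms: the arc relation is irreflexive and antisymmetric
(no loops, and never arcs in both directions between two vertices). -/
def IsA (M : ADigraph V) : Prop :=
  (∀ v, ¬ M.arc v v) ∧ ∀ u v, M.arc u v → ¬ M.arc v u

/-- Isomorphism of a-digraphs. -/
def Iso (M : ADigraph V) (N : ADigraph W) : Prop :=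
  ∃ e : V ≃ W, ∀ u v, M.arc u v ↔ N.arc (e u) (e v)

/-- Induced subdigraph on a set of vertices. -/
def induce (M : ADigraph V) (S : Set V) : ADigraph S :=
  ⟨fun u v => M.arc (u : V) (v : V)⟩

/-- `g` is an automorphism of `M`. -/
def IsAuto (M : ADigraph V) (g : V ≃ V) : Prop :=
  ∀ u v, M.arc u v ↔ M.arc (g u) (g v)

/-- `M` is set-homogeneous: whenever two finite sets of vertices induce
isomorphic subdigraphs, some automorphism maps one set onto the other. -/
def SetHomogeneous (M : ADigraph V) : Prop :=
  ∀ U U' : Set V, U.Finite → U'.Finite → (M.induce U).Iso (M.induce U') →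
    ∃ g : V ≃ V, M.IsAuto g ∧ ⇑g '' U = U'

/-- `M` is homogeneous: every isomorphism between finite induced subdigraphs
extends to an automorphism. -/
def Homogeneous (M : ADigraph V) : Prop :=
  ∀ U U' : Set V, U.Finite → U'.Finite → ∀ e : U ≃ U',
    (∀ u v : U, M.arc (u : V) (v : V) ↔ M.arc (e u : V) (e v : V)) →
    ∃ g : V ≃ V, M.IsAuto g ∧ ∀ u : U, g (u : V) = (e u : V)

/-- `M` is `k`-homogeneous: every isomorphism between induced subdigraphs of
size `k` extends to an automorphism. -/
def KHomogeneous (M : ADigraph V) (k : ℕ) : Prop :=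
  ∀ U U' : Set V, U.Finite → U'.Finite → U.ncard = k → U'.ncard = k →
    ∀ e : U ≃ U',
      (∀ u v : U, M.arc (u : V) (v : V) ↔ M.arc (e u : V) (e v : V)) →
      ∃ g : V ≃ V, M.IsAuto g ∧ ∀ u : U, g (u : V) = (e u : V)

/-- The directed `n`-cycle `D_n`: vertices `ZMod n`, arcs `i → i + 1`.
(For `n = 1` this is a single vertex with no arcs.) -/
def dirCycle (n : ℕ) : ADigraph (ZMod n) :=
  ⟨fun i j => j = i + 1 ∧ i ≠ j⟩

/-- `K̄_n`: the a-digraph on `n` vertices with no arcs. -/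
def kbar (n : ℕ) : ADigraph (Fin n) :=
  ⟨fun _ _ => False⟩

/-- The a-digraph with no arcs on an arbitrary vertex type. -/
def kbarOn (N : Type*) : ADigraph N :=
  ⟨fun _ _ => False⟩

/-- The compositional product `M[N]`. -/
def comp (M : ADigraph V) (N : ADigraph W) : ADigraph (V × W) :=
  ⟨fun p q => M.arc p.1 q.1 ∨ (p.1 = q.1 ∧ N.arc p.2 q.2)⟩

/-- `M` is connected: any two vertices are joined by a path of arcs,
ignoring orientation. -/
def Connected (M : ADigraph V) : Prop :=
  ∀ u v : V, Relation.ReflTransGen (fun a b => M.arc a b ∨ M.arc b a) u v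

/-- `H₀`: vertices the 8 nonzero vectors of `GF(3)²`, with an arc `u → v` iff
the determinant of the `2 × 2` matrix with columns `u`, `v` equals `1`. -/
def H0 : ADigraph {v : Fin 2 → ZMod 3 // v ≠ 0} :=
  ⟨fun u v => u.1 0 * v.1 1 - u.1 1 * v.1 0 = 1⟩

end ADigraph

open ADigraph

open scoped Pointwise

namespace ADigraph

variable {V : Type*} {M : ADigraph V}

/-- The automorphism group of an a-digraph, as a group of permutations of its vertices. -/
def autGroup (M : ADigraph V) : Subgroup (Equiv.Perm V) where
  carrier := {g | M.IsAuto g}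
  one_mem' := fun _ _ => Iff.rfl
  mul_mem' := fun {g h} hg hh u v => (hh u v).trans (hg (h u) (h v))
  inv_mem' := fun {g} hg u v => by
    simpa using (hg (g⁻¹ u) (g⁻¹ v)).symm

/-- `f` lists distinct vertices of `M` whose arcs are prescribed by `R`. -/
def Realizes {k : ℕ} (M : ADigraph V) (R : Fin k → Fin k → Prop) (f : Fin k → V) : Prop :=
  Function.Injective f ∧ ∀ i j, M.arc (f i) (f j) ↔ R i j

/-- The vertex sets of the copies of `R` in `M`. -/
def copies {k : ℕ} (M : ADigraph V) (R : Fin k → Fin k → Prop) : Set (Finset V) :=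
  {s | ∃ f, M.Realizes R f ∧ (s : Set V) = Set.range f}

theorem Realizes.comp_isAuto {k : ℕ} {R : Fin k → Fin k → Prop} {f : Fin k → V}
    (hf : M.Realizes R f) {g : V ≃ V} (hg : M.IsAuto g) : M.Realizes R (g ∘ f) :=
  ⟨g.injective.comp hf.1, fun i j => (hg _ _).symm.trans (hf.2 i j)⟩

theorem SetHomogeneous.exists_isAuto_image_range (hsh : M.SetHomogeneous) {k : ℕ}
    {R : Fin k → Fin k → Prop} {f f' : Fin k → V} (hf : M.Realizes R f)
    (hf' : M.Realizes R f') :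
    ∃ g : V ≃ V, M.IsAuto g ∧ ⇑g '' Set.range f = Set.range f' := by
  refine hsh _ _ (Set.finite_range f) (Set.finite_range f')
    ⟨(Equiv.ofInjective f hf.1).symm.trans (Equiv.ofInjective f' hf'.1), ?_⟩
  rintro ⟨_, i, rfl⟩ ⟨_, j, rfl⟩
  have h (i : Fin k) : (Equiv.ofInjective f hf.1).symm ⟨f i, i, rfl⟩ = i :=
    Equiv.ofInjective_symm_apply hf.1 i
  simp only [induce, Equiv.trans_apply, h, Equiv.ofInjective_apply]
  exact (hf.2 i j).trans (hf'.2 i j).symm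

/-- The automorphism group of a finite tournament has odd order. -/
theorem odd_card_autGroup [Finite V] (hM : M.IsA)
    (htour : ∀ u v : V, u ≠ v → M.arc u v ∨ M.arc v u) : Odd (Nat.card M.autGroup) := by
  rw [← Nat.not_even_iff_odd, even_iff_two_dvd]
  intro h
  have : Fact (Nat.Prime 2) := ⟨Nat.prime_two⟩
  obtain ⟨g, hg⟩ := exists_prime_orderOf_dvd_card' 2 h
  have hne : (g : Equiv.Perm V) ≠ 1 := by
    intro h1
    have : g = 1 := Subtype.ext h1
    simp [this] at hg
  have hsq : ∀ u, (g : Equiv.Perm V) ((g : Equiv.Perm V) u) = u := by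
    intro u
    have h2 : g * g = 1 := by rw [← pow_two, ← hg, pow_orderOf_eq_one]
    have h3 : (g : Equiv.Perm V) * g = 1 := congrArg Subtype.val h2
    exact DFunLike.congr_fun h3 u
  obtain ⟨u, hu⟩ : ∃ u, (g : Equiv.Perm V) u ≠ u := by
    by_contra! hc
    exact hne (Equiv.ext hc)
  have hflip := g.2 u ((g : Equiv.Perm V) u)
  rw [hsq] at hflip
  rcases htour _ _ hu with h' | h'
  · exact hM.2 _ _ h' (hflip.2 h')
  · exact hM.2 _ _ h' (hflip.1 h')

theorem SetHomogeneous.odd_ncard_copies [Finite V] (hsh : M.SetHomogeneous) (hM : M.IsA)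
    (htour : ∀ u v : V, u ≠ v → M.arc u v ∨ M.arc v u) {k : ℕ} {R : Fin k → Fin k → Prop}
    {f : Fin k → V} (hf : M.Realizes R f) : Odd (M.copies R).ncard := by
  classical
  have horbit : M.copies R = MulAction.orbit M.autGroup (Finset.univ.image f) := by
    ext s
    constructor
    · rintro ⟨f', hf', hs⟩
      obtain ⟨g, hg, himg⟩ := hsh.exists_isAuto_image_range hf hf'
      refine ⟨⟨g, hg⟩, ?_⟩
      rw [← Finset.coe_inj, hs, ← himg]
      ext v
      simp [Set.mem_smul_set, Subgroup.smul_def, Equiv.eq_symm_apply]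
    · rintro ⟨g, rfl⟩
      refine ⟨(g : Equiv.Perm V) ∘ f, hf.comp_isAuto g.2, ?_⟩
      ext v
      simp [Set.mem_smul_set, Subgroup.smul_def]
  refine (odd_card_autGroup hM htour).of_dvd_nat ?_
  rw [horbit, ← Nat.card_coe_set_eq,
    Nat.card_congr (MulAction.orbitEquivQuotientStabilizer M.autGroup _)]
  exact Subgroup.card_quotient_dvd_card _

/-- The arc pattern of the directed triangle. -/
def cyclicTriple (i j : Fin 3) : Prop := j = i + 1

theorem IsA.ne (hM : M.IsA) {u v : V} (h : M.arc u v) : u ≠ v := by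
  rintro rfl
  exact hM.1 _ h

theorem realizes_singleton (hM : M.IsA) (u : V) :
    M.Realizes (fun _ _ : Fin 1 => False) ![u] :=
  ⟨Function.injective_of_subsingleton _, fun i j => by simp [hM.1]⟩

theorem realizes_arc (hM : M.IsA) {u v : V} (h : M.arc u v) :
    M.Realizes (fun i j : Fin 2 => i < j) ![u, v] := by
  have := hM.ne h
  constructor
  · simp [Function.Injective, Fin.forall_fin_two, this, this.symm]
  · simp [Fin.forall_fin_two, hM.1, h, hM.2 _ _ h]

theorem realizes_transitive (hM : M.IsA) {u v w : V} (h : M.arc u v) (h' : M.arc v w)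
    (h'' : M.arc u w) : M.Realizes (fun i j : Fin 3 => i < j) ![u, v, w] := by
  have h1 := hM.ne h
  have h2 := hM.ne h'
  have h3 := hM.ne h''
  constructor
  · intro i j
    fin_cases i <;> fin_cases j <;> simp [h1, h1.symm, h2, h2.symm, h3, h3.symm]
  · intro i j
    fin_cases i <;> fin_cases j <;>
      simp [hM.1, h, h', h'', hM.2 _ _ h, hM.2 _ _ h', hM.2 _ _ h'']

theorem realizes_cyclic (hM : M.IsA) {u v w : V} (h : M.arc u v) (h' : M.arc v w)
    (h'' : M.arc w u) : M.Realizes cyclicTriple ![u, v, w] := by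
  have h1 := hM.ne h
  have h2 := hM.ne h'
  have h3 := hM.ne h''
  constructor
  · intro i j
    fin_cases i <;> fin_cases j <;> simp [h1, h1.symm, h2, h2.symm, h3, h3.symm]
  · intro i j
    fin_cases i <;> fin_cases j <;>
      simp [cyclicTriple, hM.1, h, h', h'', hM.2 _ _ h, hM.2 _ _ h', hM.2 _ _ h'']

theorem card_of_mem_copies {k : ℕ} {R : Fin k → Fin k → Prop} {s : Finset V}
    (hs : s ∈ M.copies R) : s.card = k := by
  obtain ⟨f, hf, hs⟩ := hs
  rw [← Set.ncard_coe_finset, hs, ← Set.image_univ, Set.ncard_image_of_injective _ hf.1]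
  simp

theorem ncard_setOf_card_eq [Fintype V] (k : ℕ) :
    {s : Finset V | s.card = k}.ncard = (Fintype.card V).choose k := by
  have : {s : Finset V | s.card = k} = (Finset.univ.powersetCard k : Finset (Finset V)) := by
    ext s
    simp
  rw [this, Set.ncard_coe_finset, Finset.card_powersetCard, Finset.card_univ]

theorem copies_singleton (hM : M.IsA) :
    M.copies (fun _ _ : Fin 1 => False) = {s | s.card = 1} := by
  refine Set.Subset.antisymm (fun s => card_of_mem_copies) fun s hs => ?_
  obtain ⟨u, rfl⟩ := Finset.card_eq_one.1 hs
  exact ⟨_, realizes_singleton hM u, by simp⟩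

theorem copies_arc (hM : M.IsA) (htour : ∀ u v : V, u ≠ v → M.arc u v ∨ M.arc v u) :
    M.copies (fun i j : Fin 2 => i < j) = {s | s.card = 2} := by
  classical
  refine Set.Subset.antisymm (fun s => card_of_mem_copies) fun s hs => ?_
  obtain ⟨u, v, huv, rfl⟩ := Finset.card_eq_two.1 hs
  rcases htour u v huv with h | h
  · exact ⟨_, realizes_arc hM h, by ext; simp; tauto⟩
  · exact ⟨_, realizes_arc hM h, by simp⟩

theorem copies_transitive_union_copies_cyclic (hM : M.IsA)
    (htour : ∀ u v : V, u ≠ v → M.arc u v ∨ M.arc v u) :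
    M.copies (fun i j : Fin 3 => i < j) ∪ M.copies cyclicTriple = {s | s.card = 3} := by
  classical
  refine Set.Subset.antisymm
    (Set.union_subset (fun s => card_of_mem_copies) (fun s => card_of_mem_copies))
    fun s hs => ?_
  obtain ⟨u, v, w, huv, huw, hvw, rfl⟩ := Finset.card_eq_three.1 hs
  have hrange (a b c : V) (h : ({u, v, w} : Set V) = {a, b, c}) :
      (({u, v, w} : Finset V) : Set V) = Set.range ![a, b, c] := by
    rw [Finset.coe_insert, Finset.coe_pair, h]
    ext
    simp
    tauto
  have mem_trans {a b c : V} (h : M.arc a b) (h' : M.arc b c) (h'' : M.arc a c)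
      (hset : ({u, v, w} : Set V) = {a, b, c}) :
      ({u, v, w} : Finset V) ∈ M.copies (fun i j : Fin 3 => i < j) ∪ M.copies cyclicTriple :=
    Or.inl ⟨_, realizes_transitive hM h h' h'', hrange a b c hset⟩
  have mem_cyclic {a b c : V} (h : M.arc a b) (h' : M.arc b c) (h'' : M.arc c a)
      (hset : ({u, v, w} : Set V) = {a, b, c}) :
      ({u, v, w} : Finset V) ∈ M.copies (fun i j : Fin 3 => i < j) ∪ M.copies cyclicTriple :=
    Or.inr ⟨_, realizes_cyclic hM h h' h'', hrange a b c hset⟩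
  rcases htour u v huv with h | h <;> rcases htour v w hvw with h' | h' <;>
    rcases htour u w huw with h'' | h''
  · exact mem_trans h h' h'' rfl
  · exact mem_cyclic h h' h'' rfl
  · exact mem_trans h'' h' h (by ext; simp; tauto)
  · exact mem_trans h'' h h' (by ext; simp; tauto)
  · exact mem_trans h h'' h' (by ext; simp; tauto)
  · exact mem_trans h' h'' h (by ext; simp; tauto)
  · exact mem_cyclic h'' h' h (by ext; simp; tauto)
  · exact mem_trans h' h h'' (by ext; simp; tauto)

theorem disjoint_copies_transitive_copies_cyclic :
    Disjoint (M.copies (fun i j : Fin 3 => i < j)) (M.copies cyclicTriple) := by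
  rw [Set.disjoint_left]
  rintro s ⟨f, hf, hs⟩ ⟨f', hf', hs'⟩
  obtain ⟨i, hi⟩ : f 2 ∈ Set.range f' := by
    rw [← hs', hs]
    exact ⟨2, rfl⟩
  obtain ⟨j, hj⟩ : f' (i + 1) ∈ Set.range f := by
    rw [← hs, hs']
    exact ⟨i + 1, rfl⟩
  have harc : M.arc (f 2) (f j) := by
    rw [← hi, hj]
    exact (hf'.2 _ _).2 rfl
  have hlt := (hf.2 _ _).1 harc
  omega

theorem SetHomogeneous.exists_arc_right [Finite V] [Nontrivial V] (hsh : M.SetHomogeneous)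
    (hM : M.IsA) (htour : ∀ u v : V, u ≠ v → M.arc u v ∨ M.arc v u) (u : V) :
    ∃ v, M.arc u v := by
  obtain ⟨a, b, hab⟩ : ∃ a b, M.arc a b := by
    obtain ⟨a, b, hab⟩ := exists_pair_ne V
    rcases htour a b hab with h | h
    exacts [⟨_, _, h⟩, ⟨_, _, h⟩]
  obtain ⟨g, hg, himg⟩ :=
    hsh.exists_isAuto_image_range (realizes_singleton hM a) (realizes_singleton hM u)
  have hau : g a = u := by simpa using himg
  exact ⟨g b, hau ▸ (hg a b).1 hab⟩

theorem SetHomogeneous.exists_cyclic [Finite V] [Nontrivial V] (hsh : M.SetHomogeneous)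
    (hM : M.IsA) (htour : ∀ u v : V, u ≠ v → M.arc u v ∨ M.arc v u) :
    ∃ u v w, M.arc u v ∧ M.arc v w ∧ M.arc w u := by
  by_contra! hc
  have : IsTrans V (Function.swap M.arc) := ⟨fun a b c hab hbc => by
    have hne : a ≠ c := by
      rintro rfl
      exact hM.2 _ _ hab hbc
    exact (htour a c hne).resolve_left fun hac => hc a c b hac hbc hab⟩
  have : Std.Irrefl (Function.swap M.arc) := ⟨hM.1⟩
  obtain ⟨u, -, hu⟩ := (Finite.wellFounded_of_trans_of_irrefl (Function.swap M.arc)).has_min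
    Set.univ Set.univ_nonempty
  obtain ⟨v, hv⟩ := hsh.exists_arc_right hM htour u
  exact hu v trivial hv

theorem exists_transitive [Fintype V]
    (htour : ∀ u v : V, u ≠ v → M.arc u v ∨ M.arc v u) (hcard : 4 ≤ Fintype.card V) :
    ∃ u v w, M.arc u v ∧ M.arc v w ∧ M.arc u w := by
  obtain ⟨f⟩ : Nonempty (Fin 4 ↪ V) := Function.Embedding.nonempty_of_card_le (by simpa)
  by_contra! hc
  have h01 := htour (f 0) (f 1) (by simp)
  have h02 := htour (f 0) (f 2) (by simp)
  have h03 := htour (f 0) (f 3) (by simp)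
  have h12 := htour (f 1) (f 2) (by simp)
  have h13 := htour (f 1) (f 3) (by simp)
  have h23 := htour (f 2) (f 3) (by simp)
  grind

theorem SetHomogeneous.card_le_three [Fintype V] (hsh : M.SetHomogeneous) (hM : M.IsA)
    (htour : ∀ u v : V, u ≠ v → M.arc u v ∨ M.arc v u) (hodd : Odd (Fintype.card V)) :
    Fintype.card V ≤ 3 := by
  by_contra! hcard
  have : Nontrivial V := Fintype.one_lt_card_iff_nontrivial.1 (by omega)
  obtain ⟨a, b, c, hab, hbc, hac⟩ := exists_transitive htour hcard
  obtain ⟨u, v, w, huv, hvw, hwu⟩ := hsh.exists_cyclic hM htour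
  have h2 := hsh.odd_ncard_copies hM htour (realizes_arc hM hab)
  rw [copies_arc hM htour, ncard_setOf_card_eq] at h2
  have h3 := (hsh.odd_ncard_copies hM htour (realizes_transitive hM hab hbc hac)).add_odd
    (hsh.odd_ncard_copies hM htour (realizes_cyclic hM huv hvw hwu))
  rw [← Set.ncard_union_eq disjoint_copies_transitive_copies_cyclic,
    copies_transitive_union_copies_cyclic hM htour, ncard_setOf_card_eq] at h3
  have hprod := h2.mul (Nat.Odd.sub_even (by omega) hodd even_two)
  rw [← Nat.choose_succ_right_eq] at hprod
  exact Nat.not_even_iff_odd.2 hprod (h3.mul_right _)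

theorem iso_dirCycle_three [Fintype V] (hM : M.IsA) (hcard : Fintype.card V = 3) {u v w : V}
    (huv : M.arc u v) (hvw : M.arc v w) (hwu : M.arc w u) : M.Iso (dirCycle 3) := by
  have hf := realizes_cyclic hM huv hvw hwu
  have hbij : Function.Bijective ![u, v, w] :=
    (Fintype.bijective_iff_injective_and_card _).2 ⟨hf.1, by simp [hcard]⟩
  let φ : Fin 3 ≃ V := Equiv.ofBijective _ hbij
  refine ⟨φ.symm, fun a b => ?_⟩
  have h := hf.2 (φ.symm a) (φ.symm b)
  have hval (x : V) : ![u, v, w] (φ.symm x) = x := φ.apply_symm_apply x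
  rw [hval, hval] at h
  refine h.trans ⟨fun h => ⟨h, fun hab => ?_⟩, fun h => h.1⟩
  have hne : φ.symm a ≠ φ.symm a + 1 := by simp
  exact hne (hab.trans h)

theorem homogeneous_of_iso_dirCycle_three (h : M.Iso (dirCycle 3)) : M.Homogeneous := by
  obtain ⟨φ, hφ⟩ := h
  have harc (u v : V) : M.arc u v ↔ φ v = φ u + 1 :=
    (hφ u v).trans ⟨fun h => h.1, fun h => ⟨h, fun h' => by simp [← h'] at h⟩⟩
  intro U U' _ _ e he
  rcases U.eq_empty_or_nonempty with rfl | ⟨a, ha⟩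
  · exact ⟨Equiv.refl V, fun _ _ => Iff.rfl, fun u => u.2.elim⟩
  refine ⟨(φ.trans (Equiv.addRight (φ (e ⟨a, ha⟩) - φ a))).trans φ.symm, fun u v => ?_,
    fun u => ?_⟩
  · simp only [harc, Equiv.trans_apply, Equiv.apply_symm_apply, Equiv.coe_addRight]
    rw [add_right_comm, add_left_inj]
  · simp only [Equiv.trans_apply, Equiv.coe_addRight, Equiv.symm_apply_eq]
    have h1 := he ⟨a, ha⟩ u
    have h2 := he u ⟨a, ha⟩
    have h3 : φ u = φ a → φ (e u) = φ (e ⟨a, ha⟩) := fun h => by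
      rw [show u = ⟨a, ha⟩ from Subtype.ext (φ.injective h)]
    simp only [harc] at h1 h2
    generalize φ (e u) = x at *
    generalize φ (e ⟨a, ha⟩) = y at *
    generalize φ u = z at *
    generalize φ a = t at *
    clear hφ harc he
    revert x y z t
    decide

end ADigraph

/-- Every finite set-homogeneous tournament is homogeneous,
and hence has exactly one vertex or is isomorphic to `D₃`. -/
theorem finite_set_homogeneous_tournament
    {V : Type} [Fintype V] [Nonempty V] (M : ADigraph V) (hM : M.IsA)
    (htour : ∀ u v : V, u ≠ v → M.arc u v ∨ M.arc v u)
    (hsh : M.SetHomogeneous) :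
    M.Homogeneous ∧ (Fintype.card V = 1 ∨ M.Iso (dirCycle 3)) := by
  have hodd : Odd (Fintype.card V) := by
    have h := hsh.odd_ncard_copies hM htour (realizes_singleton hM (Classical.arbitrary V))
    rwa [copies_singleton hM, ncard_setOf_card_eq, Nat.choose_one_right] at h
  rcases Nat.lt_or_ge 1 (Fintype.card V) with hlt | hle
  · have : Nontrivial V := Fintype.one_lt_card_iff_nontrivial.1 hlt
    have hcard : Fintype.card V = 3 := by
      have := hsh.card_le_three hM htour hodd
      obtain ⟨m, hm⟩ := hodd
      omega
    obtain ⟨u, v, w, huv, hvw, hwu⟩ := hsh.exists_cyclic hM htour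
    have hiso := iso_dirCycle_three hM hcard huv hvw hwu
    exact ⟨homogeneous_of_iso_dirCycle_three hiso, Or.inr hiso⟩
  · have : Subsingleton V := Fintype.card_le_one_iff_subsingleton.1 hle
    exact ⟨fun _ _ _ _ _ _ => ⟨Equiv.refl V, fun _ _ => Iff.rfl, fun _ => Subsingleton.elim _ _⟩,
      Or.inl (le_antisymm hle Fintype.card_pos)⟩
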